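/- For every nonnegative integer N, sum_{k=0}^{N} [4k+1] * (q^{-1};q^2)_k (q;q^2)_k^3 / ((q^4;q^2)_k (q^2;q^2)_k^3) * q^{2k} = (q;q^2)_N (q;q^2)_{N+1}^3 / ((1-q)^3 (q^4;q^2)_N (q^2;q^2)_N^3), as an identity of rational functions in q, where [m]=(1-q^m)/(1-q). -/

import Mathlib

open Finset Polynomial

/-- The `q`-shifted factorial `(a;q)_k`. -/
noncomputable def qp {F : Type*} [Field F] (a q : F) (k : ℕ) : F :=
  ∏ j ∈ Finset.range k, (1 - a * q ^ j)

/-- The `q`-integer `[m]` as a rational function. -/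
noncomputable def qint (m : ℕ) : RatFunc ℚ :=
  ∑ i ∈ Finset.range m, RatFunc.X ^ i

/-- The `q`-integer `[m]` as a polynomial. -/
noncomputable def qnat (m : ℕ) : Polynomial ℚ :=
  ∑ i ∈ Finset.range m, Polynomial.X ^ i

/-- The `q`-binomial coefficient as a rational function. -/
noncomputable def qbin (n k : ℕ) : RatFunc ℚ :=
  qp RatFunc.X RatFunc.X n / (qp RatFunc.X RatFunc.X k * qp RatFunc.X RatFunc.X (n - k))

theorem RatFunc.X_pow_ne_one {n : ℕ} (hn : n ≠ 0) : (RatFunc.X : RatFunc ℚ) ^ n ≠ 1 := by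
  intro h
  rw [← RatFunc.algebraMap_X, ← map_pow, ← map_one (algebraMap ℚ[X] (RatFunc ℚ))] at h
  have hdeg := congrArg Polynomial.natDegree (RatFunc.algebraMap_injective ℚ h)
  simp [hn] at hdeg

theorem qp_succ {F : Type*} [Field F] (a q : F) (k : ℕ) :
    qp a q (k + 1) = qp a q k * (1 - a * q ^ k) :=
  Finset.prod_range_succ _ _

theorem qp_succ_left {F : Type*} [Field F] (a q : F) (k : ℕ) :
    qp a q (k + 1) = (1 - a) * qp (a * q) q k := by
  simp only [qp, Finset.prod_range_succ', pow_zero, mul_one, pow_succ']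
  rw [mul_comm]
  simp only [mul_assoc]

theorem qp_X_pow_ne_zero {m n : ℕ} (hm : m ≠ 0) (k : ℕ) :
    qp ((RatFunc.X : RatFunc ℚ) ^ m) (RatFunc.X ^ n) k ≠ 0 := by
  refine Finset.prod_ne_zero_iff.mpr fun j _ => ?_
  rw [← pow_mul, ← pow_add, sub_ne_zero]
  exact (RatFunc.X_pow_ne_one (by omega)).symm

theorem qint_mul_one_sub_X (m : ℕ) : qint m * (1 - RatFunc.X) = 1 - RatFunc.X ^ m :=
  geom_sum_mul_neg _ _

/-- closed form for the partial sums. -/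
theorem stmt6 (N : ℕ) :
    letI q : RatFunc ℚ := RatFunc.X
    ∑ k ∈ Finset.range (N + 1),
      qint (4 * k + 1) * qp (q ^ (-1 : ℤ)) (q ^ 2) k * (qp q (q ^ 2) k) ^ 3 /
        (qp (q ^ 4) (q ^ 2) k * (qp (q ^ 2) (q ^ 2) k) ^ 3) * q ^ (2 * k)
      = qp q (q ^ 2) N * (qp q (q ^ 2) (N + 1)) ^ 3 /
          ((1 - q) ^ 3 * qp (q ^ 4) (q ^ 2) N * (qp (q ^ 2) (q ^ 2) N) ^ 3) := by
  induction N with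
  | zero =>
    have h : (1 - RatFunc.X : RatFunc ℚ) ≠ 0 :=
      sub_ne_zero.mpr (by simpa using (RatFunc.X_pow_ne_one one_ne_zero).symm)
    simp [qp, qint, h]
  | succ N ih =>
    rw [Finset.sum_range_succ, ih]
    have hq : (RatFunc.X : RatFunc ℚ) ≠ 0 := RatFunc.X_ne_zero
    have h1 : (1 - RatFunc.X : RatFunc ℚ) ≠ 0 :=
      sub_ne_zero.mpr (by simpa using (RatFunc.X_pow_ne_one one_ne_zero).symm)
    have h2 := qp_X_pow_ne_zero (n := 2) two_ne_zero (N + 1)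
    have h4 := qp_X_pow_ne_zero (n := 2) four_ne_zero (N + 1)
    have hint : qint (4 * (N + 1) + 1) =
        (1 - RatFunc.X ^ 5 * ((RatFunc.X ^ 2) ^ N) ^ 2) / (1 - RatFunc.X) := by
      rw [eq_div_iff h1, qint_mul_one_sub_X]
      ring
    have hneg : qp ((RatFunc.X : RatFunc ℚ) ^ (-1 : ℤ)) (RatFunc.X ^ 2) (N + 1) =
        (1 - RatFunc.X⁻¹) * qp RatFunc.X (RatFunc.X ^ 2) N := by
      rw [qp_succ_left, zpow_neg_one, pow_two, inv_mul_cancel_left₀ hq]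
    have hpow : (RatFunc.X : RatFunc ℚ) ^ (2 * (N + 1)) =
        RatFunc.X ^ 2 * (RatFunc.X ^ 2) ^ N := by ring
    rw [hint, hneg, hpow, qp_succ _ _ (N + 1), pow_succ _ N]
    rw [qp_succ] at h2 h4
    rw [qp_succ (RatFunc.X ^ 4), qp_succ (RatFunc.X ^ 2), qp_succ RatFunc.X]
    generalize ((RatFunc.X : RatFunc ℚ) ^ 2) ^ N = x at *
    generalize qp (RatFunc.X : RatFunc ℚ) (RatFunc.X ^ 2) N = a at *
    generalize qp ((RatFunc.X : RatFunc ℚ) ^ 2) (RatFunc.X ^ 2) N = b at *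
    generalize qp ((RatFunc.X : RatFunc ℚ) ^ 4) (RatFunc.X ^ 2) N = c at *
    clear ih hint hneg hpow
    generalize (RatFunc.X : RatFunc ℚ) = q at *
    obtain ⟨hb, hbx⟩ := mul_ne_zero_iff.mp h2
    obtain ⟨hc, hcx⟩ := mul_ne_zero_iff.mp h4
    field_simp
    ring
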